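/- Let x, y be elements of the graph group G_F, let α be a symbol, and let p ≤ x and q ≤ y be α-peaks satisfying #_α(p⁻¹x) = #_α(q⁻¹y). Then |pq⁻¹| ≤ |xy⁻¹|. -/

import Mathlib

open Pointwise

namespace GraphGroupPaper

/-- The set of commutator relators: `gᵢ` and `gⱼ` commute for every pair of distinct
`i, j` with `{i,j} ∉ F`. -/
def Rels (k : ℕ) (F : Set (Sym2 (Fin k))) : Set (FreeGroup (Fin k)) :=
  {w | ∃ i j : Fin k, i ≠ j ∧ s(i, j) ∉ F ∧
      w = FreeGroup.of i * FreeGroup.of j * (FreeGroup.of i)⁻¹ * (FreeGroup.of j)⁻¹}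

/-- The graph group `G_F` with generators `g₁, …, g_k` and relations `gᵢgⱼ = gⱼgᵢ`
for all distinct `i, j` with `{i,j} ∉ F`. -/
abbrev Grp (k : ℕ) (F : Set (Sym2 (Fin k))) := PresentedGroup (Rels k F)

/-- The generator `gᵢ` of the graph group. -/
def gen (k : ℕ) (F : Set (Sym2 (Fin k))) (i : Fin k) : Grp k F :=
  PresentedGroup.of i

/-- The group element corresponding to a symbol: `(i, true)` stands for `gᵢ`,
`(i, false)` stands for `gᵢ⁻¹`. -/
def sym (k : ℕ) (F : Set (Sym2 (Fin k))) (α : Fin k × Bool) : Grp k F :=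
  if α.2 then gen k F α.1 else (gen k F α.1)⁻¹

/-- The product of the word `l` of symbols, as an element of the graph group. -/
def wordProd (k : ℕ) (F : Set (Sym2 (Fin k))) (l : List (Fin k × Bool)) : Grp k F :=
  (l.map (sym k F)).prod

/-- `|x|` : the length of a shortest word in the symbols representing `x`. -/
noncomputable def len {k : ℕ} {F : Set (Sym2 (Fin k))} (x : Grp k F) : ℕ :=
  sInf {n | ∃ l : List (Fin k × Bool), wordProd k F l = x ∧ l.length = n}

/-- The partial order on `G_F`:  `x ≤ y` iff `|y| = |x| + |x⁻¹y|`. -/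
def le {k : ℕ} {F : Set (Sym2 (Fin k))} (x y : Grp k F) : Prop :=
  len y = len x + len (x⁻¹ * y)

/-- `m` is the meet `x ∧ y` (greatest lower bound w.r.t. `le`). -/
def IsMeet {k : ℕ} {F : Set (Sym2 (Fin k))} (x y m : Grp k F) : Prop :=
  le m x ∧ le m y ∧ ∀ w, le w x → le w y → le w m

/-- `j` is the (finite) join `x ∨ y` (least upper bound w.r.t. `le`);
`x ∨ y` is finite iff such a `j` exists. -/
def IsJoin {k : ℕ} {F : Set (Sym2 (Fin k))} (x y j : Grp k F) : Prop :=
  le x j ∧ le y j ∧ ∀ w, le x w → le y w → le j w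

/-- `j` is the (finite) join of the set `S`. -/
def IsJoinSet {k : ℕ} {F : Set (Sym2 (Fin k))} (S : Set (Grp k F)) (j : Grp k F) : Prop :=
  (∀ s ∈ S, le s j) ∧ ∀ w, (∀ s ∈ S, le s w) → le j w

/-- `y` is a segment of `a` if `a = x·y·z` for some `x, z`. -/
def Segment {k : ℕ} {F : Set (Sym2 (Fin k))} (y a : Grp k F) : Prop :=
  ∃ x z, a = x * y * z ∧ len a = len x + len y + len z

/-- The left-invariant metric `dist(x,y) = |x⁻¹y|`. -/
noncomputable def dist {k : ℕ} {F : Set (Sym2 (Fin k))} (x y : Grp k F) : ℕ :=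
  len (x⁻¹ * y)

/-- A nonempty set `L` is convex if `x, z ∈ L` and `dist(x,y) + dist(y,z) = dist(x,z)`
imply `y ∈ L`. -/
def ConvexSet {k : ℕ} {F : Set (Sym2 (Fin k))} (L : Set (Grp k F)) : Prop :=
  L.Nonempty ∧ ∀ x z y : Grp k F, x ∈ L → z ∈ L →
    dist x y + dist y z = dist x z → y ∈ L

/-- An ideal: nonempty, downward closed, and closed under finite joins. -/
def IdealSet {k : ℕ} {F : Set (Sym2 (Fin k))} (I : Set (Grp k F)) : Prop :=
  I.Nonempty ∧ (∀ x ∈ I, ∀ y, le y x → y ∈ I) ∧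
    (∀ x ∈ I, ∀ y ∈ I, ∀ j, IsJoin x y j → j ∈ I)

/-- `H` is closed if both `H` and `H⁻¹` are ideals. -/
def ClosedSet {k : ℕ} {F : Set (Sym2 (Fin k))} (H : Set (Grp k F)) : Prop :=
  IdealSet H ∧ IdealSet H⁻¹

/-- `m` is a minimal element of `S` w.r.t. `le`. -/
def MinimalIn {k : ℕ} {F : Set (Sym2 (Fin k))} (S : Set (Grp k F)) (m : Grp k F) : Prop :=
  m ∈ S ∧ ∀ x ∈ S, le x m → x = m

/-- `l` is a reduced (i.e. shortest) word representing `x`. -/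
def MinWord {k : ℕ} {F : Set (Sym2 (Fin k))} (x : Grp k F) (l : List (Fin k × Bool)) : Prop :=
  wordProd k F l = x ∧ l.length = len x

open Classical in
/-- `#_α(x)`: the number of occurrences of the symbol `α` (not counting `α⁻¹`)
in a reduced word representing `x`. -/
noncomputable def symCount {k : ℕ} {F : Set (Sym2 (Fin k))} (α : Fin k × Bool)
    (x : Grp k F) : ℕ :=
  if h : ∃ l, MinWord x l then h.choose.count α else 0

/-- The symbol `α` occurs in `x`. -/
def Occurs {k : ℕ} {F : Set (Sym2 (Fin k))} (α : Fin k × Bool) (x : Grp k F) : Prop :=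
  0 < symCount α x

/-- `α` is a maximal symbol of `x`, i.e. `xα⁻¹ ≤ x`. -/
def MaxSym {k : ℕ} {F : Set (Sym2 (Fin k))} (α : Fin k × Bool) (x : Grp k F) : Prop :=
  le (x * (sym k F α)⁻¹) x

/-- A peak: an element with precisely one maximal symbol. -/
def IsPeak {k : ℕ} {F : Set (Sym2 (Fin k))} (p : Grp k F) : Prop :=
  ∃! α : Fin k × Bool, MaxSym α p

/-- An `α`-peak: a peak whose unique maximal symbol is `α`. -/
def AlphaPeak {k : ℕ} {F : Set (Sym2 (Fin k))} (α : Fin k × Bool) (p : Grp k F) : Prop :=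
  MaxSym α p ∧ ∀ β, MaxSym β p → β = α

/-- The set of generator indices occurring in `b`. -/
def Support {k : ℕ} {F : Set (Sym2 (Fin k))} (b : Grp k F) : Set (Fin k) :=
  {i | Occurs (i, true) b ∨ Occurs (i, false) b}

/-- `b` is connected: the generators occurring in `b` induce a connected subgraph of
the graph `([k], F)`. -/
def Conn {k : ℕ} {F : Set (Sym2 (Fin k))} (b : Grp k F) : Prop :=
  (SimpleGraph.induce (Support b) (SimpleGraph.fromEdgeSet F)).Connected

/-- `b` is cyclically reduced: `b ∧ b⁻¹ = 1`. -/
def CycRed {k : ℕ} {F : Set (Sym2 (Fin k))} (b : Grp k F) : Prop :=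
  IsMeet b b⁻¹ 1

section Words

variable {k : ℕ} {F : Set (Sym2 (Fin k))}

/-- The relation on indices saying that two distinct generators commute by definition. -/
def Link (F : Set (Sym2 (Fin k))) (i j : Fin k) : Prop := i ≠ j ∧ s(i, j) ∉ F

theorem Link.symm {i j : Fin k} (h : Link F i j) : Link F j i :=
  ⟨h.1.symm, by rw [Sym2.eq_swap]; exact h.2⟩

theorem lift_rels_eq_one {H : Type*} [Group H] (f : Fin k → H)
    (h : ∀ i j, Link F i j → f i * f j = f j * f i) :
    ∀ r ∈ Rels k F, FreeGroup.lift f r = 1 := by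
  rintro r ⟨i, j, hij, hF, rfl⟩
  simp [h i j ⟨hij, hF⟩]

theorem gen_comm {i j : Fin k} (h : Link F i j) :
    gen k F i * gen k F j = gen k F j * gen k F i := by
  have h1 : PresentedGroup.mk (Rels k F)
      (FreeGroup.of i * FreeGroup.of j * (FreeGroup.of i)⁻¹ * (FreeGroup.of j)⁻¹) = 1 :=
    (QuotientGroup.eq_one_iff _).2 (Subgroup.subset_normalClosure ⟨i, j, h.1, h.2, rfl⟩)
  simp only [map_mul, map_inv] at h1
  rw [mul_inv_eq_one, mul_inv_eq_iff_eq_mul] at h1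
  exact h1

theorem sym_comm {a b : Fin k × Bool} (h : Link F a.1 b.1) :
    Commute (sym k F a) (sym k F b) := by
  have h1 : Commute (gen k F a.1) (gen k F b.1) := gen_comm h
  unfold sym
  split_ifs <;> simp [h1]

/-- The inverse symbol. -/
def symInv (a : Fin k × Bool) : Fin k × Bool := (a.1, !a.2)

@[simp] theorem symInv_symInv (a : Fin k × Bool) : symInv (symInv a) = a := by
  simp [symInv]

@[simp] theorem symInv_fst (a : Fin k × Bool) : (symInv a).1 = a.1 := rfl

@[simp] theorem sym_symInv (a : Fin k × Bool) : sym k F (symInv a) = (sym k F a)⁻¹ := by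
  rcases a with ⟨i, _ | _⟩ <;> simp [sym, symInv]

@[simp] theorem wordProd_nil : wordProd k F [] = 1 := rfl

@[simp] theorem wordProd_cons (a : Fin k × Bool) (w : List (Fin k × Bool)) :
    wordProd k F (a :: w) = sym k F a * wordProd k F w := by
  simp [wordProd]

@[simp] theorem wordProd_append (v w : List (Fin k × Bool)) :
    wordProd k F (v ++ w) = wordProd k F v * wordProd k F w := by
  simp [wordProd]

theorem wordProd_inv (w : List (Fin k × Bool)) :
    wordProd k F (w.reverse.map symInv) = (wordProd k F w)⁻¹ := by
  induction w with
  | nil => simp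
  | cons a w ih => simpa using ih

theorem exists_wordProd_eq (x : Grp k F) : ∃ w, wordProd k F w = x := by
  have h : x ∈ Subgroup.closure (Set.range (PresentedGroup.of (rels := Rels k F))) := by
    rw [PresentedGroup.closure_range_of]; trivial
  induction h using Subgroup.closure_induction with
  | mem x hx =>
    obtain ⟨i, rfl⟩ := hx
    exact ⟨[(i, true)], by simp [sym, gen]⟩
  | one => exact ⟨[], rfl⟩
  | mul x y _ _ hx hy =>
    obtain ⟨v, rfl⟩ := hx
    obtain ⟨w, rfl⟩ := hy
    exact ⟨v ++ w, by simp⟩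
  | inv x _ hx =>
    obtain ⟨w, rfl⟩ := hx
    exact ⟨_, wordProd_inv w⟩

theorem len_wordProd_le (w : List (Fin k × Bool)) : len (wordProd k F w) ≤ w.length :=
  Nat.sInf_le ⟨w, rfl, rfl⟩

theorem exists_minWord (x : Grp k F) : ∃ w, MinWord x w := by
  obtain ⟨w, hw⟩ := exists_wordProd_eq x
  exact Nat.sInf_mem (s := {n | ∃ l, wordProd k F l = x ∧ l.length = n}) ⟨_, w, hw, rfl⟩

theorem len_mul_le (x y : Grp k F) : len (x * y) ≤ len x + len y := by
  obtain ⟨v, rfl, hv⟩ := exists_minWord x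
  obtain ⟨w, rfl, hw⟩ := exists_minWord y
  rw [← wordProd_append, ← hv, ← hw, ← List.length_append]
  exact len_wordProd_le _

theorem len_inv_le (x : Grp k F) : len x⁻¹ ≤ len x := by
  obtain ⟨w, rfl, hw⟩ := exists_minWord x
  rw [← wordProd_inv, ← hw]
  simpa using len_wordProd_le (F := F) (w.reverse.map symInv)

theorem len_inv (x : Grp k F) : len x⁻¹ = len x :=
  le_antisymm (len_inv_le x) (by simpa using len_inv_le x⁻¹)

/-- A word is reduced if it is a shortest word for its product. -/
def Reduced (F : Set (Sym2 (Fin k))) (w : List (Fin k × Bool)) : Prop :=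
  w.length ≤ len (wordProd k F w)

theorem Reduced.length_eq {w : List (Fin k × Bool)} (h : Reduced F w) :
    w.length = len (wordProd k F w) :=
  le_antisymm h (len_wordProd_le w)

theorem MinWord.reduced {x : Grp k F} {w : List (Fin k × Bool)} (h : MinWord x w) :
    Reduced F w := by
  obtain ⟨rfl, h⟩ := h
  exact h.le

theorem Reduced.left {v w : List (Fin k × Bool)} (h : Reduced F (v ++ w)) : Reduced F v := by
  have h1 := len_mul_le (wordProd k F v) (wordProd k F w)
  have h2 := len_wordProd_le (F := F) w
  unfold Reduced at *
  simp at h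
  omega

theorem Reduced.right {v w : List (Fin k × Bool)} (h : Reduced F (v ++ w)) : Reduced F w := by
  have h1 := len_mul_le (wordProd k F v) (wordProd k F w)
  have h2 := len_wordProd_le (F := F) v
  unfold Reduced at *
  simp at h
  omega

/-- The subgroup generated by the generators linked to `i`. -/
def linkSubgroup (F : Set (Sym2 (Fin k))) (i : Fin k) : Subgroup (Grp k F) :=
  Subgroup.closure (gen k F '' {j | Link F i j})

theorem commute_of_mem_linkSubgroup {i : Fin k} {x : Grp k F} (hx : x ∈ linkSubgroup F i) :
    Commute (gen k F i) x := by
  induction hx using Subgroup.closure_induction with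
  | mem x hx =>
    obtain ⟨j, hj, rfl⟩ := hx
    exact gen_comm hj
  | one => exact Commute.one_right _
  | mul x y _ _ hx hy => exact hx.mul_right hy
  | inv x _ hx => exact hx.inv_right

open Classical in
/-- The retraction of the graph group killing all generators not linked to `i`. -/
noncomputable def linkRetract (F : Set (Sym2 (Fin k))) (i : Fin k) : Grp k F →* Grp k F :=
  PresentedGroup.toGroup (f := fun j => if Link F i j then gen k F j else 1)
    (lift_rels_eq_one _ fun a b hab => by
      split_ifs <;> simp [gen_comm hab])

open Classical in
theorem linkRetract_gen (i j : Fin k) :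
    linkRetract F i (gen k F j) = if Link F i j then gen k F j else 1 :=
  PresentedGroup.toGroup.of _

theorem linkRetract_of_mem {i : Fin k} {x : Grp k F} (hx : x ∈ linkSubgroup F i) :
    linkRetract F i x = x := by
  induction hx using Subgroup.closure_induction with
  | mem x hx =>
    obtain ⟨j, hj, rfl⟩ := hx
    exact (linkRetract_gen i j).trans (if_pos hj)
  | one => simp
  | mul x y _ _ hx hy => simp [hx, hy]
  | inv x _ hx => simp [hx]

open Classical in
theorem linkRetract_wordProd (i : Fin k) (w : List (Fin k × Bool)) :
    linkRetract F i (wordProd k F w) = wordProd k F (w.filter fun a => Link F i a.1) := by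
  induction w with
  | nil => simp
  | cons a w ih =>
    by_cases h : Link F i a.1 <;> by_cases hb : a.2 <;>
      simp [h, hb, ih, sym, linkRetract_gen]

theorem Reduced.link_of_mem {i : Fin k} {w : List (Fin k × Bool)} (hw : Reduced F w)
    (h : wordProd k F w ∈ linkSubgroup F i) : ∀ a ∈ w, Link F i a.1 := by
  classical
  have h1 := linkRetract_of_mem h
  rw [linkRetract_wordProd] at h1
  have h2 := len_wordProd_le (F := F) (w.filter fun a => Link F i a.1)
  rw [h1] at h2
  have h3 := List.filter_eq_self.1
    (List.filter_sublist.eq_of_length_le (hw.trans h2))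
  simpa using h3

/-- Left translation of hyperplanes. -/
def act (g : Grp k F) (H : Fin k × Set (Grp k F)) : Fin k × Set (Grp k F) := (H.1, g • H.2)

theorem act_act (g h : Grp k F) (H : Fin k × Set (Grp k F)) :
    act g (act h H) = act (g * h) H := by
  simp [act, mul_smul]

@[simp] theorem act_one (H : Fin k × Set (Grp k F)) : act 1 H = H := by
  simp [act]

@[simp] theorem act_inv_act (g : Grp k F) (H : Fin k × Set (Grp k F)) :
    act g⁻¹ (act g H) = H := by
  simp [act_act]

@[simp] theorem act_act_inv (g : Grp k F) (H : Fin k × Set (Grp k F)) :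
    act g (act g⁻¹ H) = H := by
  simp [act_act]

/-- The hyperplane dual to the edge from `1` to the generator `i`. -/
def hyp (F : Set (Sym2 (Fin k))) (i : Fin k) : Fin k × Set (Grp k F) :=
  (i, (linkSubgroup F i : Set (Grp k F)))

theorem act_gen_hyp {i j : Fin k} (h : Link F i j) : act (gen k F j) (hyp F i) = hyp F i := by
  simp only [act, hyp]
  rw [leftCoset_mem_leftCoset]
  exact Subgroup.subset_closure ⟨j, h, rfl⟩

theorem act_eq_iff (g : Grp k F) (H K : Fin k × Set (Grp k F)) :
    act g H = K ↔ H = act g⁻¹ K := by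
  constructor
  · rintro rfl; simp
  · rintro rfl; simp

open Classical in
/-- The affine permutation of the integer-valued functions on hyperplanes given by a generator:
its linear part is translation, its constant part the hyperplane of that generator. -/
noncomputable def crossPerm (F : Set (Sym2 (Fin k))) (i : Fin k) :
    Equiv.Perm (Fin k × Set (Grp k F) → ℤ) where
  toFun f H := f (act (gen k F i)⁻¹ H) + if H = hyp F i then 1 else 0
  invFun f H := f (act (gen k F i) H) - if act (gen k F i) H = hyp F i then 1 else 0
  left_inv f := by ext H; simp
  right_inv f := by ext H; simp

open Classical in
theorem crossPerm_apply (i : Fin k) (f : Fin k × Set (Grp k F) → ℤ) (H : Fin k × Set (Grp k F)) :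
    crossPerm F i f H = f (act (gen k F i)⁻¹ H) + if H = hyp F i then 1 else 0 := rfl

open Classical in
theorem crossPerm_inv_apply (i : Fin k) (f : Fin k × Set (Grp k F) → ℤ)
    (H : Fin k × Set (Grp k F)) :
    (crossPerm F i)⁻¹ f H =
      f (act (gen k F i) H) - if act (gen k F i) H = hyp F i then 1 else 0 := rfl

theorem crossPerm_comm {i j : Fin k} (h : Link F i j) :
    crossPerm F i * crossPerm F j = crossPerm F j * crossPerm F i := by
  ext f H
  have h1 : act (gen k F i)⁻¹ H = hyp F j ↔ H = hyp F j := by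
    rw [act_eq_iff, inv_inv, act_gen_hyp h.symm]
  have h2 : act (gen k F j)⁻¹ H = hyp F i ↔ H = hyp F i := by
    rw [act_eq_iff, inv_inv, act_gen_hyp h]
  have h3 : (gen k F j)⁻¹ * (gen k F i)⁻¹ = (gen k F i)⁻¹ * (gen k F j)⁻¹ := by
    rw [← mul_inv_rev, ← mul_inv_rev, gen_comm h]
  simp only [Equiv.Perm.mul_apply, crossPerm_apply, act_act, h1, h2, h3]
  ring

/-- The affine action of the graph group on integer-valued functions on hyperplanes. -/
noncomputable def crossHom (F : Set (Sym2 (Fin k))) :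
    Grp k F →* Equiv.Perm (Fin k × Set (Grp k F) → ℤ) :=
  PresentedGroup.toGroup (f := crossPerm F) (lift_rels_eq_one _ fun _ _ => crossPerm_comm)

theorem crossHom_gen (i : Fin k) : crossHom F (gen k F i) = crossPerm F i :=
  PresentedGroup.toGroup.of _

/-- The hyperplane crossed by the edge from `1` to a symbol. -/
def symHyp (F : Set (Sym2 (Fin k))) (a : Fin k × Bool) : Fin k × Set (Grp k F) :=
  if a.2 then hyp F a.1 else act (gen k F a.1)⁻¹ (hyp F a.1)

@[simp] theorem symHyp_fst (a : Fin k × Bool) : (symHyp F a).1 = a.1 := by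
  unfold symHyp; split_ifs <;> rfl

/-- The signed hyperplanes crossed by the path from `1` spelled by a word. -/
def crossings (F : Set (Sym2 (Fin k))) :
    List (Fin k × Bool) → Multiset ((Fin k × Set (Grp k F)) × Bool)
  | [] => 0
  | a :: w => (symHyp F a, a.2) ::ₘ (crossings F w).map (Prod.map (act (sym k F a)) id)

theorem prodMap_act_injective (g : Grp k F) :
    Function.Injective (Prod.map (act g) (id : Bool → Bool)) :=
  Function.Injective.prodMap (Function.LeftInverse.injective (act_inv_act g))
    Function.injective_id

open Classical in
theorem crossHom_wordProd (w : List (Fin k × Bool)) (H : Fin k × Set (Grp k F)) :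
    crossHom F (wordProd k F w) 0 H =
      ((crossings F w).count (H, true) : ℤ) - (crossings F w).count (H, false) := by
  induction w generalizing H with
  | nil => simp [crossings]
  | cons a w ih =>
    have hc : ∀ b : Bool, ((crossings F w).map (Prod.map (act (sym k F a)) id)).count (H, b) =
        (crossings F w).count (act (sym k F a)⁻¹ H, b) := by
      intro b
      have : ((H, b) : (Fin k × Set (Grp k F)) × Bool) =
          Prod.map (act (sym k F a)) id (act (sym k F a)⁻¹ H, b) := by simp
      rw [this, Multiset.count_map_eq_count' _ _ (prodMap_act_injective _)]
    simp only [crossings, Multiset.count_cons, hc, wordProd_cons, map_mul, Equiv.Perm.mul_apply]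
    rcases a with ⟨i, _ | _⟩
    · simp only [sym, symHyp]
      simp [crossHom_gen, crossPerm_inv_apply, ih, act_eq_iff, sub_sub]
    · simp [sym, symHyp, crossHom_gen, crossPerm_apply, ih]
      ring

theorem crossings_le {v w : List (Fin k × Bool)} (h : wordProd k F v = wordProd k F w)
    (hv : ∀ H b, (H, b) ∈ crossings F v → (H, !b) ∉ crossings F v) :
    crossings F v ≤ crossings F w := by
  classical
  rw [Multiset.le_iff_count]
  rintro ⟨H, b⟩
  by_cases hb : (H, b) ∈ crossings F v
  · have h0 := Multiset.count_eq_zero.2 (hv H b hb)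
    have h1 := crossHom_wordProd v H
    rw [h, crossHom_wordProd w H] at h1
    cases b <;> simp only [Bool.not_true, Bool.not_false] at h0 <;> omega
  · rw [Multiset.count_eq_zero.2 hb]
    exact Nat.zero_le _

theorem card_crossings (w : List (Fin k × Bool)) : (crossings F w).card = w.length := by
  induction w with
  | nil => rfl
  | cons a w ih => simp [crossings, ih]

theorem map_crossings (w : List (Fin k × Bool)) :
    (crossings F w).map (fun e => (e.1.1, e.2)) = (w : Multiset (Fin k × Bool)) := by
  induction w with
  | nil => rfl
  | cons a w ih =>
    simp only [crossings, Multiset.map_cons, Multiset.map_map, symHyp_fst]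
    rw [← Multiset.cons_coe, ← ih]
    rfl

theorem mem_crossings {w : List (Fin k × Bool)} {H : Fin k × Set (Grp k F)} {b : Bool}
    (h : (H, b) ∈ crossings F w) :
    ∃ u a v, w = u ++ a :: v ∧ H = act (wordProd k F u) (symHyp F a) ∧ a.2 = b := by
  induction w generalizing H with
  | nil => simp [crossings] at h
  | cons s w ih =>
    simp only [crossings, Multiset.mem_cons, Multiset.mem_map, Prod.mk.injEq, Prod.exists,
      Prod.map_apply, id] at h
    rcases h with ⟨rfl, rfl⟩ | ⟨i, S, c, hK, rfl, rfl⟩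
    · exact ⟨[], s, w, rfl, by simp, rfl⟩
    · obtain ⟨u, a, v, rfl, h, rfl⟩ := ih hK
      exact ⟨s :: u, a, v, rfl, by simp [h, act_act], rfl⟩

/-- A word has a cancellation if it contains a symbol and its inverse such that the product of the
symbols in between lies in the link subgroup. -/
def Cancels (F : Set (Sym2 (Fin k))) (w : List (Fin k × Bool)) : Prop :=
  ∃ u a v t, w = u ++ a :: (v ++ symInv a :: t) ∧ wordProd k F v ∈ linkSubgroup F a.1

theorem mem_linkSubgroup_of_symHyp {a b : Fin k × Bool} {g : Grp k F}
    (h : symHyp F a = act (sym k F a * g) (symHyp F b)) (hb : b.2 = !a.2) :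
    b = symInv a ∧ g ∈ linkSubgroup F a.1 := by
  have h1 : a.1 = b.1 := by simpa [act] using congrArg Prod.fst h
  have hba : b = symInv a := Prod.ext h1.symm hb
  refine ⟨hba, ?_⟩
  subst hba
  rcases a with ⟨i, _ | _⟩
  · have h2 := congrArg Prod.snd h
    simp only [symHyp, sym, symInv, act, hyp, mul_smul] at h2
    simp at h2
    have : g ∈ g • (linkSubgroup F i : Set (Grp k F)) := by
      simp [mem_leftCoset_iff]
    rw [← h2] at this
    exact this
  · have h2 := congrArg Prod.snd h
    simp only [symHyp, sym, symInv, act, hyp] at h2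
    simp [smul_smul] at h2
    set x := gen k F i * g * (gen k F i)⁻¹ with hx
    have h3 : x ∈ x • (linkSubgroup F i : Set (Grp k F)) := by
      simp [mem_leftCoset_iff]
    rw [← h2] at h3
    have h4 := commute_of_mem_linkSubgroup h3
    have h5 : g = x := by
      have : g = (gen k F i)⁻¹ * (x * gen k F i) := by rw [hx]; group
      rw [this, ← h4.eq]; group
    change g ∈ linkSubgroup F i
    rw [h5]; exact h3

theorem cancels_of_mem_crossings {w : List (Fin k × Bool)} {H : Fin k × Set (Grp k F)} {b : Bool}
    (h : (H, b) ∈ crossings F w) (h' : (H, !b) ∈ crossings F w) : Cancels F w := by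
  induction w generalizing H b with
  | nil => simp [crossings] at h
  | cons s w ih =>
    have key : ∀ K, (K, !s.2) ∈ crossings F w → symHyp F s = act (sym k F s) K →
        Cancels F (s :: w) := by
      intro K hK hs
      obtain ⟨u, a, v, rfl, rfl, ha⟩ := mem_crossings hK
      rw [act_act] at hs
      obtain ⟨rfl, hu⟩ := mem_linkSubgroup_of_symHyp hs ha
      exact ⟨[], s, u, v, rfl, hu⟩
    simp only [crossings, Multiset.mem_cons, Multiset.mem_map, Prod.mk.injEq, Prod.exists,
      Prod.map_apply, id] at h h'
    rcases h with ⟨rfl, rfl⟩ | ⟨i, S, c, hK, rfl, rfl⟩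
    · rcases h' with ⟨_, h'⟩ | ⟨i, S, c, hK, hs, rfl⟩
      · simp at h'
      · exact key _ hK hs.symm
    · rcases h' with ⟨hs, h'⟩ | ⟨i', S', c', hK', hs, rfl⟩
      · exact key _ (by simpa [← h'] using hK) hs.symm
      · have : (i', S') = (i, S) := by simpa using congrArg (act (sym k F s)⁻¹) hs
        rw [this] at hK'
        obtain ⟨u, a, v, t, rfl, hv⟩ := ih hK hK'
        exact ⟨s :: u, a, v, t, rfl, hv⟩

theorem sym_commute_of_mem {a : Fin k × Bool} {x : Grp k F} (hx : x ∈ linkSubgroup F a.1) :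
    Commute (sym k F a) x := by
  have h := commute_of_mem_linkSubgroup hx
  unfold sym
  split_ifs
  · exact h
  · exact h.inv_left

theorem not_reduced_of_cancels {w : List (Fin k × Bool)} (h : Cancels F w) : ¬ Reduced F w := by
  obtain ⟨u, a, v, t, rfl, hv⟩ := h
  intro hr
  have h1 := len_wordProd_le (F := F) (u ++ (v ++ t))
  have h2 : wordProd k F (u ++ a :: (v ++ symInv a :: t)) = wordProd k F (u ++ (v ++ t)) := by
    simp only [wordProd_append, wordProd_cons, sym_symInv, ← mul_assoc]
    rw [mul_assoc _ (sym k F a), (sym_commute_of_mem hv).eq]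
    group
  unfold Reduced at hr
  rw [h2] at hr
  simp at h1 hr
  omega

theorem cancels_of_not_reduced {w : List (Fin k × Bool)} (h : ¬ Reduced F w) : Cancels F w := by
  by_contra hc
  obtain ⟨v, hv, hl⟩ := exists_minWord (wordProd k F w)
  have h1 := crossings_le hv.symm fun H b hb hb' => hc (cancels_of_mem_crossings hb hb')
  have h2 := Multiset.card_le_card h1
  rw [card_crossings, card_crossings] at h2
  exact h (h2.trans hl.le)

theorem Reduced.perm {v w : List (Fin k × Bool)} (hv : Reduced F v) (hw : Reduced F w)
    (h : wordProd k F v = wordProd k F w) : v.Perm w := by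
  have key : ∀ {u}, Reduced F u → ∀ H b, (H, b) ∈ crossings F u → (H, !b) ∉ crossings F u :=
    fun hu H b hb hb' => not_reduced_of_cancels (cancels_of_mem_crossings hb hb') hu
  have h1 := le_antisymm (crossings_le h (key hv)) (crossings_le h.symm (key hw))
  rw [← Multiset.coe_eq_coe, ← map_crossings, ← map_crossings, h1]

theorem reduced_singleton (a : Fin k × Bool) : Reduced F [a] := by
  by_contra h
  obtain ⟨u, b, v, t, h, -⟩ := cancels_of_not_reduced h
  have := congrArg List.length h
  simp at this
  omega

theorem len_sym (a : Fin k × Bool) : len (sym k F a) = 1 := by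
  simpa using (reduced_singleton (F := F) a).length_eq.symm

theorem maxSym_iff {a : Fin k × Bool} {x : Grp k F} :
    MaxSym a x ↔ len (x * (sym k F a)⁻¹) + 1 = len x := by
  have h : (x * (sym k F a)⁻¹)⁻¹ * x = sym k F a := by group
  unfold MaxSym le
  rw [h, len_sym, eq_comm]

theorem len_le_len_mul_sym_inv (a : Fin k × Bool) (x : Grp k F) :
    len x ≤ len (x * (sym k F a)⁻¹) + 1 := by
  simpa [len_sym] using len_mul_le (x * (sym k F a)⁻¹) (sym k F a)

theorem maxSym_of_lt {a : Fin k × Bool} {x : Grp k F} (h : len (x * (sym k F a)⁻¹) < len x) :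
    MaxSym a x :=
  maxSym_iff.2 (le_antisymm h (len_le_len_mul_sym_inv a x))

theorem commute_wordProd {a : Fin k × Bool} {w : List (Fin k × Bool)}
    (h : ∀ b ∈ w, Link F a.1 b.1) : Commute (sym k F a) (wordProd k F w) := by
  induction w with
  | nil => exact Commute.one_right _
  | cons b w ih =>
    rw [wordProd_cons]
    exact (sym_comm (h b (by simp))).mul_right (ih fun c hc => h c (by simp [hc]))

/-- If a reduced word becomes non-reduced when a symbol is appended, then the inverse of this symbol
can be shuffled to the end of the word. -/
theorem Reduced.exists_split {a : Fin k × Bool} {w : List (Fin k × Bool)} (hw : Reduced F w)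
    (h : ¬ Reduced F (w ++ [symInv a])) :
    ∃ u v, w = u ++ a :: v ∧ ∀ b ∈ v, Link F a.1 b.1 := by
  obtain ⟨u, b, v, t, ht, hv⟩ := cancels_of_not_reduced h
  rcases List.eq_nil_or_concat t with rfl | ⟨t, c, rfl⟩
  · have h1 : w ++ [symInv a] = (u ++ b :: v) ++ [symInv b] := by simpa using ht
    obtain ⟨h2, h3⟩ := List.append_inj' h1 rfl
    obtain rfl : a = b := by
      have := congrArg symInv (List.singleton_inj.1 h3)
      simpa using this
    subst h2
    have h4 : Reduced F ([a] ++ v) := Reduced.right hw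
    exact ⟨u, v, rfl, h4.right.link_of_mem hv⟩
  · have h1 : w ++ [symInv a] = (u ++ b :: (v ++ symInv b :: t)) ++ [c] := by
      simpa using ht
    obtain ⟨h2, -⟩ := List.append_inj' h1 rfl
    exact absurd hw (not_reduced_of_cancels ⟨u, b, v, t, h2, hv⟩)

theorem Reduced.exists_split_of_maxSym {a : Fin k × Bool} {w : List (Fin k × Bool)}
    (hw : Reduced F w) (h : MaxSym a (wordProd k F w)) :
    ∃ u v, w = u ++ a :: v ∧ ∀ b ∈ v, Link F a.1 b.1 := by
  refine hw.exists_split fun hr => ?_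
  rw [maxSym_iff] at h
  unfold Reduced at hr
  have := len_wordProd_le (F := F) w
  simp at hr
  omega

theorem wordProd_split {a : Fin k × Bool} {u v : List (Fin k × Bool)}
    (h : ∀ b ∈ v, Link F a.1 b.1) :
    wordProd k F (u ++ a :: v) * (sym k F a)⁻¹ = wordProd k F (u ++ v) := by
  simp only [wordProd_append, wordProd_cons, mul_assoc]
  rw [← (commute_wordProd h).inv_left.eq, mul_inv_cancel_left]

theorem Reduced.maxSym_of_split {a : Fin k × Bool} {u v : List (Fin k × Bool)}
    (hr : Reduced F (u ++ a :: v)) (h : ∀ b ∈ v, Link F a.1 b.1) :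
    MaxSym a (wordProd k F (u ++ a :: v)) := by
  refine maxSym_of_lt ?_
  rw [wordProd_split h, ← hr.length_eq]
  refine (len_wordProd_le _).trans_lt ?_
  simp

/-- A maximal symbol of a reduced product is maximal in the right factor, or maximal in the left
factor and linked to all symbols of the right factor. -/
theorem Reduced.maxSym_append {a : Fin k × Bool} {v w : List (Fin k × Bool)}
    (hr : Reduced F (v ++ w)) (h : MaxSym a (wordProd k F (v ++ w))) :
    MaxSym a (wordProd k F w) ∨
      (MaxSym a (wordProd k F v) ∧ ∀ b ∈ w, Link F a.1 b.1) := by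
  obtain ⟨c, d, hcd, hd⟩ := hr.exists_split_of_maxSym h
  rcases List.append_eq_append_iff.1 hcd with ⟨e, rfl, rfl⟩ | ⟨e, rfl, he⟩
  · exact .inl (hr.right.maxSym_of_split hd)
  · cases e with
    | nil =>
      simp only [List.nil_append] at he
      subst he
      exact .inl (Reduced.maxSym_of_split (u := []) hr.right hd)
    | cons b e =>
      obtain ⟨rfl, rfl⟩ := List.cons.inj he
      exact .inr ⟨hr.left.maxSym_of_split fun b hb => hd b (by simp [hb]),
        fun b hb => hd b (by simp [hb])⟩

theorem wordProd_mem_linkSubgroup {i : Fin k} {w : List (Fin k × Bool)}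
    (h : ∀ b ∈ w, Link F i b.1) : wordProd k F w ∈ linkSubgroup F i := by
  induction w with
  | nil => exact one_mem _
  | cons b w ih =>
    rw [wordProd_cons]
    refine mul_mem ?_ (ih fun c hc => h c (by simp [hc]))
    have hb : gen k F b.1 ∈ linkSubgroup F i :=
      Subgroup.subset_closure ⟨b.1, h b (by simp), rfl⟩
    unfold sym
    split_ifs
    · exact hb
    · exact inv_mem hb

theorem exists_common_maxSym_of_not_reduced {v w : List (Fin k × Bool)} (hv : Reduced F v)
    (hw : Reduced F w) (h : ¬ Reduced F (v ++ w)) :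
    ∃ a, MaxSym a (wordProd k F v) ∧ MaxSym a (wordProd k F w)⁻¹ := by
  induction w using List.reverseRecOn with
  | nil => simp [hv] at h
  | append_singleton z t ih =>
    have hl := hw.length_eq
    have hz := len_wordProd_le (F := F) z
    have hz' := hw.left.length_eq
    simp only [List.length_append, List.length_singleton] at hl
    by_cases hr : Reduced F (v ++ z)
    · have h' : ¬ Reduced F ((v ++ z) ++ [symInv (symInv t)]) := by simpa using h
      obtain ⟨c, d, hcd, hd⟩ := hr.exists_split h'
      have hz_split : ∀ e, z ≠ e ++ symInv t :: d := by
        rintro e rfl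
        exact not_reduced_of_cancels
          ⟨e, symInv t, d, [], by simp, wordProd_mem_linkSubgroup hd⟩ hw
      rcases List.append_eq_append_iff.1 hcd with ⟨e, -, he⟩ | ⟨e, rfl, he⟩
      · exact absurd he (hz_split e)
      · cases e with
        | nil => exact absurd he.symm (hz_split [])
        | cons b e =>
          obtain ⟨rfl, rfl⟩ := List.cons.inj he
          refine ⟨symInv t, hv.maxSym_of_split fun b hb => hd b (by simp [hb]), maxSym_of_lt ?_⟩
          have hc : Commute (sym k F t) (wordProd k F z) :=
            commute_wordProd fun b hb => hd b (by simp [hb])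
          have h1 : (wordProd k F (z ++ [t]))⁻¹ * (sym k F (symInv t))⁻¹ = (wordProd k F z)⁻¹ := by
            simp [← hc.eq]
          rw [h1, len_inv, len_inv]
          omega
    · obtain ⟨a, ha, hb⟩ := ih hw.left hr
      refine ⟨a, ha, maxSym_of_lt ?_⟩
      rw [maxSym_iff, ← mul_inv_rev, len_inv, len_inv] at hb
      rw [← mul_inv_rev, len_inv, len_inv, wordProd_append, ← mul_assoc]
      have h1 := len_mul_le (sym k F a * wordProd k F z) (wordProd k F [t])
      have h2 := len_wordProd_le (F := F) [t]
      rw [wordProd_append] at hl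
      simp only [List.length_singleton] at h2
      omega

theorem MinWord.append {x y : Grp k F} {v w : List (Fin k × Bool)} (hv : MinWord x v)
    (hw : MinWord y w) (h : len (x * y) = len x + len y) : MinWord (x * y) (v ++ w) := by
  obtain ⟨rfl, hv⟩ := hv
  obtain ⟨rfl, hw⟩ := hw
  exact ⟨wordProd_append v w, by rw [List.length_append, h, hv, hw]⟩

theorem exists_common_maxSym {x y : Grp k F} (h : len (x * y⁻¹) < len x + len y) :
    ∃ a, MaxSym a x ∧ MaxSym a y := by
  obtain ⟨v, hv⟩ := exists_minWord x
  obtain ⟨w, hw⟩ := exists_minWord y⁻¹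
  have hr : ¬ Reduced F (v ++ w) := by
    unfold Reduced
    rw [wordProd_append, hv.1, hw.1, List.length_append, hv.2, hw.2, len_inv]
    omega
  simpa [hv.1, hw.1] using exists_common_maxSym_of_not_reduced hv.reduced hw.reduced hr

theorem maxSym_mul {a : Fin k × Bool} {x y : Grp k F} (hxy : len (x * y) = len x + len y)
    (h : MaxSym a (x * y)) :
    MaxSym a y ∨ (MaxSym a x ∧ ∀ w, MinWord y w → ∀ b ∈ w, Link F a.1 b.1) := by
  refine or_iff_not_imp_left.2 fun hy => ?_
  obtain ⟨v, hv⟩ := exists_minWord x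
  have key : ∀ w, MinWord y w → MaxSym a x ∧ ∀ b ∈ w, Link F a.1 b.1 := by
    intro w hw
    have hvw := hv.append hw hxy
    have h1 := hvw.reduced.maxSym_append (by rwa [hvw.1])
    rw [hv.1, hw.1] at h1
    exact h1.resolve_left hy
  obtain ⟨w, hw⟩ := exists_minWord y
  exact ⟨(key w hw).1, fun w hw => (key w hw).2⟩

theorem MaxSym.exists_eq {a : Fin k × Bool} {x : Grp k F} (h : MaxSym a x) :
    ∃ y, x = y * sym k F a ∧ len (y * sym k F a) = len y + 1 := by
  refine ⟨x * (sym k F a)⁻¹, by simp, ?_⟩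
  rw [inv_mul_cancel_right, maxSym_iff.1 h]

theorem MinWord.append_singleton {a : Fin k × Bool} {x : Grp k F} {w : List (Fin k × Bool)}
    (hw : MinWord x w) (h : len (x * sym k F a) = len x + 1) :
    MinWord (x * sym k F a) (w ++ [a]) := by
  refine ⟨by simp [hw.1], by simp [hw.2, h]⟩

theorem MinWord.perm {x : Grp k F} {v w : List (Fin k × Bool)} (hv : MinWord x v)
    (hw : MinWord x w) : v.Perm w :=
  hv.reduced.perm hw.reduced (hv.1.trans hw.1.symm)

open Classical in
theorem symCount_eq {x : Grp k F} {w : List (Fin k × Bool)} (hw : MinWord x w)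
    (a : Fin k × Bool) : symCount a x = w.count a := by
  have h : ∃ l, MinWord x l := ⟨w, hw⟩
  rw [symCount, dif_pos h]
  exact (h.choose_spec.perm hw).count_eq a

open Classical in
theorem symCount_mul_sym {b : Fin k × Bool} {x : Grp k F} (h : len (x * sym k F b) = len x + 1)
    (a : Fin k × Bool) :
    symCount a (x * sym k F b) = symCount a x + if b = a then 1 else 0 := by
  obtain ⟨w, hw⟩ := exists_minWord x
  rw [symCount_eq (hw.append_singleton h), symCount_eq hw]
  simp [List.count_append, List.count_singleton]

/-- All generators occurring in `x` have their index in `T`. -/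
def SupportedIn (T : Set (Fin k)) (x : Grp k F) : Prop := ∀ w, MinWord x w → ∀ b ∈ w, b.1 ∈ T

theorem SupportedIn.of_mul_sym {T : Set (Fin k)} {a : Fin k × Bool} {x : Grp k F}
    (hT : SupportedIn T (x * sym k F a)) (h : len (x * sym k F a) = len x + 1) :
    a.1 ∈ T ∧ SupportedIn T x := by
  refine ⟨?_, fun w hw b hb => hT _ (hw.append_singleton h) b (by simp [hb])⟩
  obtain ⟨w, hw⟩ := exists_minWord x
  exact hT _ (hw.append_singleton h) a (by simp)

theorem SupportedIn.commute {a : Fin k × Bool} {x : Grp k F}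
    (h : SupportedIn {j | Link F a.1 j} x) : Commute (sym k F a) x := by
  obtain ⟨w, hw⟩ := exists_minWord x
  rw [← hw.1]
  exact commute_wordProd (h w hw)

theorem len_mul_cancel_right {a : Fin k × Bool} {p u : Grp k F}
    (h : len (p * (u * sym k F a)) = len p + len (u * sym k F a))
    (hu : len (u * sym k F a) = len u + 1) : len (p * u) = len p + len u := by
  have h1 := len_mul_le (p * u) (sym k F a)
  have h2 := len_mul_le p u
  rw [len_sym, mul_assoc] at h1
  omega

theorem len_mul_cancel_left {a : Fin k × Bool} {p u : Grp k F}
    (h : len (p * sym k F a * u) = len (p * sym k F a) + len u)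
    (hp : len (p * sym k F a) = len p + 1) (hc : Commute (sym k F a) u) :
    len (p * u) = len p + len u := by
  have h1 := len_mul_le (p * u) (sym k F a)
  have h2 := len_mul_le p u
  rw [len_sym, mul_assoc, ← hc.eq, ← mul_assoc] at h1
  omega

theorem maxSym_mul_sym_of_link {a b : Fin k × Bool} {p : Grp k F}
    (hp : len (p * sym k F a) = len p + 1) (hb : MaxSym b p) (h : Link F a.1 b.1) :
    MaxSym b (p * sym k F a) := by
  refine maxSym_of_lt ?_
  have h1 := len_mul_le (p * (sym k F b)⁻¹) (sym k F a)
  rw [mul_assoc, (sym_comm h).inv_right.eq, ← mul_assoc, hp]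
  rw [maxSym_iff] at hb
  rw [len_sym] at h1
  omega

theorem len_mul_inv_le {x y : Grp k F} : len (x * y⁻¹) ≤ len x + len y := by
  simpa [len_inv] using len_mul_le x y⁻¹

/-- Splitting off the largest right factors supported in `T` does not increase distances. -/
theorem len_mul_inv_le_of_supportedIn (n : ℕ) (T : Set (Fin k)) (p u q v : Grp k F)
    (hn : len p + len u < n)
    (hpu : len (p * u) = len p + len u) (hqv : len (q * v) = len q + len v)
    (hu : SupportedIn T u) (hv : SupportedIn T v)
    (hp : ∀ a, MaxSym a p → a.1 ∉ T) (hq : ∀ a, MaxSym a q → a.1 ∉ T) :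
    len (p * q⁻¹) ≤ len (p * u * (q * v)⁻¹) := by
  induction n generalizing T p u q v with
  | zero => omega
  | succ n ih =>
    by_cases hlt : len (p * u * (q * v)⁻¹) < len (p * u) + len (q * v)
    swap
    · have := len_mul_inv_le (x := p) (y := q)
      omega
    obtain ⟨a, ha, hb⟩ := exists_common_maxSym hlt
    rcases maxSym_mul hpu ha with h1 | ⟨h1, hL⟩ <;> rcases maxSym_mul hqv hb with h2 | ⟨h2, hM⟩
    · obtain ⟨u, rfl, hul⟩ := h1.exists_eq
      obtain ⟨v, rfl, hvl⟩ := h2.exists_eq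
      have := ih T p u q v (by omega) (len_mul_cancel_right hpu hul)
        (len_mul_cancel_right hqv hvl) (hu.of_mul_sym hul).2 (hv.of_mul_sym hvl).2 hp hq
      simpa [mul_assoc] using this
    · obtain ⟨u, rfl, hul⟩ := h1.exists_eq
      exact absurd (hu.of_mul_sym hul).1 (hq a h2)
    · obtain ⟨v, rfl, hvl⟩ := h2.exists_eq
      exact absurd (hv.of_mul_sym hvl).1 (hp a h1)
    · obtain ⟨p, rfl, hpl⟩ := h1.exists_eq
      obtain ⟨q, rfl, hql⟩ := h2.exists_eq
      have hcu := SupportedIn.commute hL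
      have hcv := SupportedIn.commute hM
      have := ih (T ∩ {j | Link F a.1 j}) p u q v (by omega) (len_mul_cancel_left hpu hpl hcu)
        (len_mul_cancel_left hqv hql hcv)
        (fun w hw b hb => ⟨hu w hw b hb, hL w hw b hb⟩)
        (fun w hw b hb => ⟨hv w hw b hb, hM w hw b hb⟩)
        (fun b hb hT => hp b (maxSym_mul_sym_of_link hpl hb hT.2) hT.1)
        (fun b hb hT => hq b (maxSym_mul_sym_of_link hql hb hT.2) hT.1)
      rw [hcu.right_comm p, hcv.right_comm q]
      simpa [mul_assoc] using this

theorem symCount_eq_zero_of_link {a : Fin k × Bool} {x : Grp k F}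
    (h : SupportedIn {j | Link F a.1 j} x) : symCount a x = 0 := by
  classical
  obtain ⟨w, hw⟩ := exists_minWord x
  rw [symCount_eq hw, List.count_eq_zero]
  exact fun ha => (h w hw a ha).1 rfl

theorem symCount_ne_zero_of_maxSym {a : Fin k × Bool} {x : Grp k F} (h : MaxSym a x) :
    symCount a x ≠ 0 := by
  obtain ⟨x, rfl, hx⟩ := h.exists_eq
  rw [symCount_mul_sym hx, if_pos rfl]
  omega

theorem len_mul_inv_le_of_alphaPeak (n : ℕ) {a : Fin k × Bool} {p q : Grp k F} (u v : Grp k F)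
    (hn : len u < n) (hp : AlphaPeak a p) (hq : AlphaPeak a q)
    (hpu : len (p * u) = len p + len u) (hqv : len (q * v) = len q + len v)
    (hc : symCount a u = symCount a v) :
    len (p * q⁻¹) ≤ len (p * u * (q * v)⁻¹) := by
  induction n generalizing u v with
  | zero => omega
  | succ n ih =>
    by_cases hlt : len (p * u * (q * v)⁻¹) < len (p * u) + len (q * v)
    swap
    · have := len_mul_inv_le (x := p) (y := q)
      omega
    obtain ⟨b, hb, hb'⟩ := exists_common_maxSym hlt
    rcases maxSym_mul hpu hb with h1 | ⟨h1, hL⟩ <;> rcases maxSym_mul hqv hb' with h2 | ⟨h2, hM⟩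
    · obtain ⟨u, rfl, hul⟩ := h1.exists_eq
      obtain ⟨v, rfl, hvl⟩ := h2.exists_eq
      rw [symCount_mul_sym hul, symCount_mul_sym hvl, Nat.add_right_cancel_iff] at hc
      have := ih u v (by omega) (len_mul_cancel_right hpu hul) (len_mul_cancel_right hqv hvl) hc
      simpa [mul_assoc] using this
    · obtain rfl := hq.2 b h2
      exact absurd (hc.trans (symCount_eq_zero_of_link hM)) (symCount_ne_zero_of_maxSym h1)
    · obtain rfl := hp.2 b h1
      exact absurd (hc.symm.trans (symCount_eq_zero_of_link hL)) (symCount_ne_zero_of_maxSym h2)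
    · obtain rfl := hp.2 b h1
      obtain ⟨p, rfl, hpl⟩ := h1.exists_eq
      obtain ⟨q, rfl, hql⟩ := h2.exists_eq
      have hcu := SupportedIn.commute hL
      have hcv := SupportedIn.commute hM
      have := len_mul_inv_le_of_supportedIn _ {j | Link F b.1 j} p u q v (Nat.lt_succ_self _)
        (len_mul_cancel_left hpu hpl hcu) (len_mul_cancel_left hqv hql hcv) hL hM
        (fun c hc hT => hT.1 (congrArg Prod.fst
          (hp.2 c (maxSym_mul_sym_of_link hpl hc hT))).symm)
        (fun c hc hT => hT.1 (congrArg Prod.fst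
          (hq.2 c (maxSym_mul_sym_of_link hql hc hT))).symm)
      rw [hcu.right_comm p, hcv.right_comm q]
      simpa [mul_assoc] using this

end Words

/-- for `α`-peaks `p ≤ x` and `q ≤ y` with
`#_α(p⁻¹x) = #_α(q⁻¹y)`, one has `|pq⁻¹| ≤ |xy⁻¹|`. -/
theorem stmt13 {k : ℕ} (hk : 1 ≤ k) {F : Set (Sym2 (Fin k))}
    (α : Fin k × Bool) (x y p q : Grp k F)
    (hp : AlphaPeak α p) (hq : AlphaPeak α q)
    (hpx : le p x) (hqy : le q y)
    (hc : symCount α (p⁻¹ * x) = symCount α (q⁻¹ * y)) :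
    len (p * q⁻¹) ≤ len (x * y⁻¹) := by
  have h := len_mul_inv_le_of_alphaPeak _ (p⁻¹ * x) (q⁻¹ * y) (Nat.lt_succ_self _) hp hq
    (by rw [mul_inv_cancel_left]; exact hpx) (by rw [mul_inv_cancel_left]; exact hqy) hc
  rwa [mul_inv_cancel_left, mul_inv_cancel_left] at h

end GraphGroupPaper
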